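/- arXiv:0904.1385 — 3 statements merged into one kernel-verified Lean document; each statement's English description precedes it below -/
import Mathlib

section
/- Let t₀ ≥ 1, λ ≥ 1, c ≥ 0, d > 0, and let q : [t₀,∞) → [0,∞) be continuous whose zeros are isolated, such that max{ λ·(c+d)^{λ−1}, (c+d)^λ/d } · ∫_{t₀}^∞ t^λ·q(t) dt < 1. Then the Emden–Fowler equation x''(t) + q(t)·x(t)^λ = 0 possesses a solution x defined on [t₀,∞) with c − d ≤ x'(t) < x(t)/t ≤ c + d for all t > t₀, and x(t) = c·t + o(t) as t → ∞. -/
open Real MeasureTheory Filter Topology Set Asymptotics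

/-- The signed power `x^λ := |x|^(λ-1) · x` used in the Emden-Fowler equation. -/
noncomputable def efPow (lam x : ℝ) : ℝ := |x| ^ (lam - 1) * x

/-- Truncation of `y ↦ y ^ lam` to the interval `[0, M]`. -/
noncomputable def clampPow (lam M y : ℝ) : ℝ := (max 0 (min y M)) ^ lam

lemma clampPow_nonneg (lam M y : ℝ) : 0 ≤ clampPow lam M y :=
  Real.rpow_nonneg (le_max_left _ _) _

lemma clampPow_le {lam M : ℝ} (hlam : 0 ≤ lam) (hM : 0 ≤ M) (y : ℝ) :
    clampPow lam M y ≤ M ^ lam :=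
  Real.rpow_le_rpow (le_max_left _ _) (max_le hM (min_le_right _ _)) hlam

lemma clampPow_of_mem {lam M y : ℝ} (h0 : 0 ≤ y) (hM : y ≤ M) : clampPow lam M y = y ^ lam := by
  rw [clampPow, min_eq_left hM, max_eq_right h0]

lemma continuous_clampPow {lam : ℝ} (hlam : 0 ≤ lam) (M : ℝ) : Continuous (clampPow lam M) := by
  unfold clampPow
  exact (continuous_const.max (continuous_id.min continuous_const)).rpow_const
    fun _ => Or.inr hlam

lemma abs_rpow_sub_rpow_le {lam M a b : ℝ} (hlam : 1 ≤ lam) (ha : a ∈ Icc 0 M)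
    (hb : b ∈ Icc 0 M) : |a ^ lam - b ^ lam| ≤ lam * M ^ (lam - 1) * |a - b| := by
  have h := (convex_Icc (0 : ℝ) M).norm_image_sub_le_of_norm_hasDerivWithin_le
    (f := fun y => y ^ lam) (f' := fun y => lam * y ^ (lam - 1)) (C := lam * M ^ (lam - 1))
    (fun y _ => (Real.hasDerivAt_rpow_const (Or.inr hlam)).hasDerivWithinAt)
    (fun y hy => by
      rw [Real.norm_of_nonneg (mul_nonneg (by linarith) (Real.rpow_nonneg hy.1 _))]
      exact mul_le_mul_of_nonneg_left (Real.rpow_le_rpow hy.1 hy.2 (by linarith)) (by linarith))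
    hb ha
  simpa [Real.norm_eq_abs] using h

lemma abs_clampPow_sub_le {lam M : ℝ} (hlam : 1 ≤ lam) (hM : 0 ≤ M) (a b : ℝ) :
    |clampPow lam M a - clampPow lam M b| ≤ lam * M ^ (lam - 1) * |a - b| := by
  refine (abs_rpow_sub_rpow_le (M := M) hlam ⟨le_max_left _ _, max_le hM (min_le_right _ _)⟩
    ⟨le_max_left _ _, max_le hM (min_le_right _ _)⟩).trans ?_
  refine mul_le_mul_of_nonneg_left ?_ (mul_nonneg (by linarith) (Real.rpow_nonneg hM _))
  refine (abs_max_sub_max_le_max _ _ _ _).trans (max_le (by simp) ?_)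
  exact (abs_min_sub_min_le_max _ _ _ _).trans (max_le le_rfl (by simp))

/-- A Hammerstein integral equation `u = h + ∫ k(·,τ) P(τ) φ(u(τ)) dμ(τ)` whose kernel is dominated
by `P`, with a bounded Lipschitz nonlinearity `φ`, has a continuous solution as soon as
`K * ∫ P < 1`. -/
lemma exists_hammerstein_solution {μ : Measure ℝ} {P h φ : ℝ → ℝ} {k : ℝ → ℝ → ℝ} {K M H : ℝ}
    (hP : Integrable P μ) (hP0 : ∀ᵐ τ ∂μ, 0 ≤ P τ)
    (hk : ∀ t, Measurable (k t)) (hkc : ∀ τ, Continuous fun t => k t τ)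
    (hk1 : ∀ t, ∀ᵐ τ ∂μ, |k t τ| ≤ 1)
    (hφ : Continuous φ) (hφM : ∀ y, |φ y| ≤ M) (hφK : ∀ a b, |φ a - φ b| ≤ K * |a - b|)
    (hh : Continuous h) (hH : ∀ t, |h t| ≤ H) (hK : 0 ≤ K) (hKP : K * ∫ τ, P τ ∂μ < 1) :
    ∃ u : ℝ → ℝ, Continuous u ∧ ∀ t, u t = h t + ∫ τ, k t τ * (P τ * φ (u τ)) ∂μ := by
  have hmeas : ∀ (u : ℝ → ℝ), Continuous u → ∀ t,
      AEStronglyMeasurable (fun τ => k t τ * (P τ * φ (u τ))) μ := fun u hu t =>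
    (hk t).aestronglyMeasurable.mul
      (hP.aestronglyMeasurable.mul (hφ.comp hu).aestronglyMeasurable)
  have hbound : ∀ (u : ℝ → ℝ) (t : ℝ), ∀ᵐ τ ∂μ, ‖k t τ * (P τ * φ (u τ))‖ ≤ P τ * M := by
    intro u t
    filter_upwards [hP0, hk1 t] with τ h0 h1
    rw [norm_mul, norm_mul, Real.norm_of_nonneg h0, Real.norm_eq_abs, Real.norm_eq_abs]
    exact (mul_le_of_le_one_left (by positivity) h1).trans
      (mul_le_mul_of_nonneg_left (hφM _) h0)
  have hint : ∀ (u : ℝ → ℝ), Continuous u → ∀ t,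
      Integrable (fun τ => k t τ * (P τ * φ (u τ))) μ := fun u hu t =>
    (hP.mul_const M).mono' (hmeas u hu t) (hbound u t)
  let T : BoundedContinuousFunction ℝ ℝ → BoundedContinuousFunction ℝ ℝ := fun u =>
    BoundedContinuousFunction.ofNormedAddCommGroup
      (fun t => h t + ∫ τ, k t τ * (P τ * φ (u τ)) ∂μ)
      (hh.add (continuous_of_dominated (hmeas u u.continuous) (hbound u) (hP.mul_const M)
        (Eventually.of_forall fun τ => (hkc τ).mul continuous_const)))
      (H + ∫ τ, P τ * M ∂μ)
      (fun t => (norm_add_le _ _).trans (add_le_add (hH t)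
        (norm_integral_le_of_norm_le (hP.mul_const M) (hbound u t))))
  have hI : 0 ≤ ∫ τ, P τ ∂μ := integral_nonneg_of_ae hP0
  have hT : ContractingWith (NNReal.mk (K * ∫ τ, P τ ∂μ) (mul_nonneg hK hI)) T := by
    refine ⟨by exact_mod_cast hKP, LipschitzWith.of_dist_le_mul fun u v => ?_⟩
    rw [NNReal.coe_mk]
    refine (BoundedContinuousFunction.dist_le
      (mul_nonneg (mul_nonneg hK hI) dist_nonneg)).2 fun t => ?_
    change dist (h t + ∫ τ, k t τ * (P τ * φ (u τ)) ∂μ)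
      (h t + ∫ τ, k t τ * (P τ * φ (v τ)) ∂μ) ≤ _
    rw [dist_add_left, dist_eq_norm,
      ← integral_sub (hint u u.continuous t) (hint v v.continuous t)]
    calc _ ≤ ∫ τ, P τ * (K * dist u v) ∂μ := by
          refine norm_integral_le_of_norm_le (hP.mul_const _) ?_
          filter_upwards [hP0, hk1 t] with τ h0 h1
          rw [← mul_sub, ← mul_sub, norm_mul, norm_mul, Real.norm_of_nonneg h0, Real.norm_eq_abs,
            Real.norm_eq_abs]
          refine (mul_le_of_le_one_left (by positivity) h1).trans
            (mul_le_mul_of_nonneg_left ((hφK _ _).trans ?_) h0)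
          exact mul_le_mul_of_nonneg_left
            (BoundedContinuousFunction.dist_coe_le_dist (f := u) (g := v) τ) hK
      _ = K * (∫ τ, P τ ∂μ) * dist u v := by rw [integral_mul_const]; ring
  refine ⟨_, (hT.fixedPoint T).continuous, fun t => ?_⟩
  conv_lhs => rw [← hT.fixedPoint_isFixedPt]
  rfl

lemma rpow_mul_eq_efPow {lam t y : ℝ} (ht : 0 < t) (hy : 0 < y) :
    t ^ lam * y ^ lam = efPow lam (t * y) := by
  have h : 0 < t * y := mul_pos ht hy
  rw [efPow, abs_of_pos h, Real.rpow_sub_one h.ne', div_mul_cancel₀ _ h.ne',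
    Real.mul_rpow ht.le hy.le]

/-- Splitting the integral with kernel `min (τ / t) 1` at `τ = t`. -/
lemma integral_min_div_mul {a t : ℝ} (ha : 0 < a) (hat : a ≤ t) {g : ℝ → ℝ} (hg : Continuous g)
    (hgi : IntegrableOn g (Ici a)) :
    ∫ τ in Ici a, min (τ / t) 1 * g τ =
      (∫ τ in a..t, τ * g τ) / t + ((∫ τ in Ici a, g τ) - ∫ τ in a..t, g τ) := by
  have ht : 0 < t := ha.trans_le hat
  rw [integral_Ici_eq_integral_Ioi, integral_Ici_eq_integral_Ioi]
  rw [integrableOn_Ici_iff_integrableOn_Ioi] at hgi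
  have hgt : IntegrableOn g (Ioi t) := hgi.mono_set (Ioi_subset_Ioi hat)
  have h1 : ∀ τ ∈ Ioc a t, min (τ / t) 1 * g τ = τ * g τ / t := fun τ hτ => by
    rw [min_eq_left ((div_le_one ht).2 hτ.2)]; ring
  have h2 : ∀ τ ∈ Ioi t, min (τ / t) 1 * g τ = g τ := fun τ hτ => by
    rw [min_eq_right ((one_le_div ht).2 (le_of_lt hτ)), one_mul]
  have hc : Continuous fun τ => min (τ / t) 1 * g τ := by fun_prop
  rw [← Ioc_union_Ioi_eq_Ioi hat,
    setIntegral_union Ioc_disjoint_Ioi_same measurableSet_Ioi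
      (hc.integrableOn_Icc.mono_set Ioc_subset_Icc_self)
      (hgt.congr_fun (fun τ hτ => (h2 τ hτ).symm) measurableSet_Ioi),
    setIntegral_union Ioc_disjoint_Ioi_same measurableSet_Ioi
      (hg.integrableOn_Icc.mono_set Ioc_subset_Icc_self) hgt,
    setIntegral_congr_fun measurableSet_Ioc h1, setIntegral_congr_fun measurableSet_Ioi h2,
    intervalIntegral.integral_of_le hat, intervalIntegral.integral_of_le hat, integral_div]
  ring

lemma tendsto_integral_min_div_mul {a : ℝ} (ha : 0 < a) {g : ℝ → ℝ} (hg : Continuous g)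
    (hgi : IntegrableOn g (Ici a)) :
    Tendsto (fun t => ∫ τ in Ici a, min (τ / t) 1 * g τ) atTop (𝓝 0) := by
  have h := tendsto_integral_filter_of_dominated_convergence (μ := volume.restrict (Ici a))
    (l := atTop) (F := fun t τ => min (τ / t) 1 * g τ) (f := fun _ => 0) (fun τ => ‖g τ‖)
    (Eventually.of_forall fun t =>
      (by fun_prop : Continuous fun τ => min (τ / t) 1 * g τ).aestronglyMeasurable)
    (by
      filter_upwards [eventually_gt_atTop 0] with t ht
      filter_upwards [ae_restrict_mem measurableSet_Ici] with τ hτ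
      have hτ0 : 0 ≤ τ := ha.le.trans hτ
      rw [norm_mul, Real.norm_of_nonneg (le_min (by positivity) zero_le_one)]
      exact mul_le_of_le_one_left (norm_nonneg _) (min_le_right _ _))
    hgi.norm
    (Eventually.of_forall fun τ => by
      have h0 : Tendsto (fun t : ℝ => min (τ / t) 1) atTop (𝓝 (min 0 1)) :=
        (tendsto_const_nhds.div_atTop tendsto_id).min tendsto_const_nhds
      simpa using h0.mul_const (g τ))
  simpa using h

/-- If `max{λ(c+d)^{λ-1}, (c+d)^λ/d}·∫_{t₀}^∞ t^λ q(t) dt < 1`, the Emden-Fowler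
equation possesses a solution on `[t₀,∞)` with `c - d ≤ x'(t) < x(t)/t ≤ c + d` for
`t > t₀` and `x(t) = c·t + o(t)` as `t → ∞`. -/
theorem stmt_15 (t₀ lam c d : ℝ) (ht₀ : 1 ≤ t₀) (hlam : 1 ≤ lam)
    (hc : 0 ≤ c) (hd : 0 < d)
    (q : ℝ → ℝ) (hq_cont : ContinuousOn q (Set.Ici t₀))
    (hq_nonneg : ∀ t ∈ Set.Ici t₀, 0 ≤ q t)
    (hq_iso : ∀ t ∈ Set.Ici t₀, q t = 0 → ∀ᶠ s in 𝓝[≠] t, q s ≠ 0)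
    (hq_int : IntegrableOn (fun t => t ^ lam * q t) (Set.Ici t₀))
    (hmax : max (lam * (c + d) ^ (lam - 1)) ((c + d) ^ lam / d) *
      (∫ t in Set.Ici t₀, t ^ lam * q t) < 1) :
    ∃ x x' : ℝ → ℝ,
      (∀ t ∈ Set.Ici t₀, HasDerivAt x (x' t) t ∧
        HasDerivAt x' (-(q t * efPow lam (x t))) t) ∧
      (∀ t, t₀ < t → c - d ≤ x' t ∧ x' t < x t / t ∧ x t / t ≤ c + d) ∧
      (fun t => x t - c * t) =o[atTop] fun t : ℝ => t := by
  have h0 : 0 < t₀ := by linarith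
  have hM : 0 < c + d := by linarith
  set I := ∫ t in Ici t₀, t ^ lam * q t with hI
  have hP0 : ∀ᵐ τ ∂volume.restrict (Ici t₀), 0 ≤ τ ^ lam * q τ := by
    filter_upwards [ae_restrict_mem measurableSet_Ici] with τ hτ
    exact mul_nonneg (Real.rpow_nonneg (h0.le.trans hτ) _) (hq_nonneg τ hτ)
  have hI0 : 0 ≤ I := integral_nonneg_of_ae hP0
  have hKI : lam * (c + d) ^ (lam - 1) * I < 1 :=
    (mul_le_mul_of_nonneg_right (le_max_left _ _) hI0).trans_lt hmax
  have hMI : (c + d) ^ lam * I < d := by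
    have h := (mul_le_mul_of_nonneg_right (le_max_right _ _) hI0).trans_lt hmax
    rwa [div_mul_eq_mul_div, div_lt_one hd] at h
  -- A positive value of `x - t x'` at `t₀` makes the strict inequality hold even when `c = 0`.
  obtain ⟨w₀, hw₀, hw₀d⟩ : ∃ w₀, 0 < w₀ ∧ w₀ + (c + d) ^ lam * I < d :=
    ⟨(d - (c + d) ^ lam * I) / 2, by linarith, by linarith⟩
  have hmax0 : ∀ t : ℝ, 0 < max t t₀ := fun t => h0.trans_le (le_max_right _ _)
  have hdiv : ∀ t, w₀ / max t t₀ ≤ w₀ := fun t =>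
    div_le_self hw₀.le (ht₀.trans (le_max_right _ _))
  have hk1 : ∀ t, ∀ τ ∈ Ici t₀, 0 ≤ min (τ / max t t₀) 1 := fun t τ hτ =>
    le_min (div_nonneg (h0.le.trans hτ) (hmax0 t).le) zero_le_one
  obtain ⟨u, huc, hu⟩ := exists_hammerstein_solution (μ := volume.restrict (Ici t₀))
    (P := fun τ => τ ^ lam * q τ) (h := fun t => c + w₀ / max t t₀)
    (φ := clampPow lam (c + d)) (k := fun t τ => min (τ / max t t₀) 1)
    (K := lam * (c + d) ^ (lam - 1)) (M := (c + d) ^ lam) (H := c + w₀)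
    hq_int hP0 (fun t => by fun_prop)
    (fun τ => (continuous_const.div (by fun_prop) fun t => (hmax0 t).ne').min continuous_const)
    (fun t => by
      filter_upwards [ae_restrict_mem measurableSet_Ici] with τ hτ
      rw [abs_of_nonneg (hk1 t τ hτ)]
      exact min_le_right _ _)
    (continuous_clampPow (by linarith) _)
    (fun y => by
      rw [abs_of_nonneg (clampPow_nonneg _ _ _)]
      exact clampPow_le (by linarith) hM.le y)
    (abs_clampPow_sub_le hlam hM.le)
    (continuous_const.add (continuous_const.div (by fun_prop) fun t => (hmax0 t).ne'))
    (fun t => by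
      rw [abs_of_nonneg (add_nonneg hc (div_nonneg hw₀.le (hmax0 t).le))]
      linarith [hdiv t])
    (by positivity) hKI
  let g : ℝ → ℝ := fun τ =>
    (max τ t₀) ^ lam * q (max τ t₀) * clampPow lam (c + d) (u τ)
  have hg_eq : ∀ τ ∈ Ici t₀, g τ = τ ^ lam * q τ * clampPow lam (c + d) (u τ) := fun τ hτ => by
    simp only [g, max_eq_left (mem_Ici.1 hτ)]
  have hgc : Continuous g := by
    refine (((continuous_id.max continuous_const).rpow_const
      fun τ => Or.inl (hmax0 τ).ne').mul ?_).mul ((continuous_clampPow (by linarith) _).comp huc)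
    exact hq_cont.comp_continuous (by fun_prop) fun τ => mem_Ici.2 (le_max_right _ _)
  have hg0 : ∀ τ, 0 ≤ g τ := fun τ =>
    mul_nonneg (mul_nonneg (Real.rpow_nonneg (hmax0 τ).le _)
      (hq_nonneg _ (mem_Ici.2 (le_max_right _ _))))
      (clampPow_nonneg _ _ _)
  have hg_le : ∀ τ ∈ Ici t₀, g τ ≤ τ ^ lam * q τ * (c + d) ^ lam := fun τ hτ => by
    rw [hg_eq τ hτ]
    exact mul_le_mul_of_nonneg_left (clampPow_le (by linarith) hM.le _)
      (mul_nonneg (Real.rpow_nonneg (h0.le.trans hτ) _) (hq_nonneg τ hτ))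
  have hgi : IntegrableOn g (Ici t₀) := by
    refine Integrable.mono' (hq_int.mul_const ((c + d) ^ lam)) hgc.aestronglyMeasurable ?_
    filter_upwards [ae_restrict_mem measurableSet_Ici] with τ hτ
    rw [Real.norm_of_nonneg (hg0 τ)]
    exact hg_le τ hτ
  have hu' : ∀ t ∈ Ici t₀, u t = c + w₀ / t + ∫ τ in Ici t₀, min (τ / t) 1 * g τ := by
    intro t ht
    rw [hu t, max_eq_left (mem_Ici.1 ht)]
    congr 1
    refine setIntegral_congr_fun measurableSet_Ici fun τ hτ => ?_
    simp only [hg_eq τ hτ]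
  have hJ : ∫ τ in Ici t₀, g τ ≤ (c + d) ^ lam * I := by
    rw [mul_comm, hI, ← integral_mul_const]
    exact setIntegral_mono_on hgi (hq_int.mul_const _) measurableSet_Ici hg_le
  have hu_pos : ∀ t ∈ Ici t₀, 0 < u t := fun t ht => by
    have ht' : 0 < t := h0.trans_le ht
    rw [hu' t ht]
    have := setIntegral_nonneg (μ := volume) (f := fun τ => min (τ / t) 1 * g τ)
      (measurableSet_Ici (a := t₀)) fun τ hτ =>
      mul_nonneg (le_min (div_nonneg (h0.le.trans hτ) ht'.le) zero_le_one) (hg0 τ)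
    have : 0 < w₀ / t := by positivity
    linarith
  have hu_le : ∀ t ∈ Ici t₀, u t ≤ c + d := fun t ht => by
    have ht' : 0 < t := h0.trans_le ht
    rw [hu' t ht]
    have h1 : ∫ τ in Ici t₀, min (τ / t) 1 * g τ ≤ ∫ τ in Ici t₀, g τ := by
      refine integral_mono_of_nonneg ?_ hgi (Eventually.of_forall fun τ =>
        mul_le_of_le_one_left (hg0 τ) (min_le_right _ _))
      filter_upwards [ae_restrict_mem measurableSet_Ici] with τ hτ
      exact mul_nonneg (le_min (div_nonneg (h0.le.trans hτ) ht'.le) zero_le_one) (hg0 τ)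
    have h2 := hdiv t
    rw [max_eq_left (mem_Ici.1 ht)] at h2
    linarith
  let J := ∫ τ in Ici t₀, g τ
  let y : ℝ → ℝ := fun t => c + (J - ∫ τ in t₀..t, g τ)
  let w : ℝ → ℝ := fun t => w₀ + ∫ τ in t₀..t, τ * g τ
  let x : ℝ → ℝ := fun t => t * y t + w t
  have hux : ∀ t ∈ Ici t₀, u t = y t + w t / t := fun t ht => by
    rw [hu' t ht, integral_min_div_mul h0 ht hgc hgi]
    simp only [y, w, J]
    ring
  have hxu : ∀ t ∈ Ici t₀, x t = t * u t := fun t ht => by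
    have ht' : 0 < t := h0.trans_le ht
    rw [hux t ht]
    simp only [x]
    field_simp
  have hy' : ∀ t, HasDerivAt y (-g t) t := fun t =>
    ((hgc.integral_hasStrictDerivAt t₀ t).hasDerivAt.const_sub J).const_add c
  have hw' : ∀ t, HasDerivAt w (t * g t) t := fun t =>
    ((by fun_prop : Continuous fun τ => τ * g τ).integral_hasStrictDerivAt
      t₀ t).hasDerivAt.const_add w₀
  refine ⟨x, y, fun t ht => ⟨?_, ?_⟩, fun t ht => ⟨?_, ?_, ?_⟩, ?_⟩
  · exact (((hasDerivAt_id t).mul (hy' t)).add (hw' t)).congr_deriv (by simp only [id_eq]; ring)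
  · have ht' : 0 < t := h0.trans_le ht
    convert hy' t using 2
    rw [hg_eq t ht, clampPow_of_mem (hu_pos t ht).le (hu_le t ht), hxu t ht,
      ← rpow_mul_eq_efPow ht' (hu_pos t ht)]
    ring
  · have h1 : ∫ τ in t₀..t, g τ ≤ J := by
      rw [intervalIntegral.integral_of_le ht.le]
      exact setIntegral_mono_set hgi (Eventually.of_forall hg0)
        (LE.le.eventuallyLE (Ioc_subset_Icc_self.trans Icc_subset_Ici_self))
    simp only [y]
    linarith
  · have ht' : 0 < t := h0.trans ht
    have hw : 0 < w t := add_pos_of_pos_of_nonneg hw₀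
      (intervalIntegral.integral_nonneg ht.le fun τ hτ => mul_nonneg (h0.le.trans hτ.1) (hg0 τ))
    rw [hxu t ht.le, mul_div_cancel_left₀ _ ht'.ne', hux t ht.le]
    exact lt_add_of_pos_right _ (div_pos hw ht')
  · rw [hxu t ht.le, mul_div_cancel_left₀ _ (h0.trans ht).ne']
    exact hu_le t ht.le
  · refine (isLittleO_iff_tendsto' ?_).2 ?_
    · filter_upwards [eventually_gt_atTop 0] with t ht h
      exact absurd h ht.ne'
    · have h1 : Tendsto (fun t : ℝ => w₀ / t + ∫ τ in Ici t₀, min (τ / t) 1 * g τ) atTop (𝓝 0) := by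
        simpa using (tendsto_const_nhds.div_atTop tendsto_id).add
          (tendsto_integral_min_div_mul h0 hgc hgi)
      refine h1.congr' ?_
      filter_upwards [eventually_ge_atTop t₀] with t ht
      have ht' : 0 < t := h0.trans_le ht
      rw [hxu t ht, mul_comm c, ← mul_sub, mul_div_cancel_left₀ _ ht'.ne', hu' t ht]
      ring
end

section
/- Let s₀ ≥ 1, h₀ > 0, and let k : [s₀,∞) → [0,∞) be continuous. Define H(τ) := −exp(−∫_{s₀}^τ k(ξ) dξ) and h₁(s) := s·( h₀/s₀ + ∫_{s₀}^s H(τ)/τ² dτ ) for s ≥ s₀. Then h₁ is twice continuously differentiable and satisfies h₁''(s) + k(s)·( h₁'(s) − h₁(s)/s ) = 0 for all s ≥ s₀, and moreover (h₀ − 1)/s₀ ≤ h₁(s)/s ≤ h₀/s₀ for all s ≥ s₀. -/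
open Real MeasureTheory Filter Topology Set Asymptotics

/-- One-sided fundamental theorem of calculus for a function continuous on `[a, ∞)`. -/
theorem hasDerivWithinAt_integral_Ici {f : ℝ → ℝ} {a : ℝ} (hf : ContinuousOn f (Set.Ici a))
    {s : ℝ} (hs : s ∈ Set.Ici a) :
    HasDerivWithinAt (fun u => ∫ t in a..u, f t) (f s) (Set.Ici a) s := by
  have hg : Continuous fun t => f (max a t) :=
    hf.comp_continuous (by fun_prop) fun t => le_max_left a t
  have hcongr : ∀ u ∈ Set.Ici a, ∫ t in a..u, f t = ∫ t in a..u, f (max a t) := by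
    intro u hu
    refine intervalIntegral.integral_congr fun t ht => ?_
    rw [Set.uIcc_of_le hu] at ht
    simp only [max_eq_right ht.1]
  have hd := (hg.integral_hasStrictDerivAt a s).hasDerivAt.hasDerivWithinAt (s := Set.Ici a)
  rw [max_eq_right hs] at hd
  exact hd.congr hcongr (hcongr s hs)

/-- With `H(τ) = -exp(-∫_{s₀}^τ k)` and `h₁(s) = s·(h₀/s₀ + ∫_{s₀}^s H(τ)/τ² dτ)`, the
function `h₁` is twice continuously differentiable on `[s₀,∞)`, satisfies
`h₁'' + k(s)·(h₁' - h₁/s) = 0` there, and `(h₀-1)/s₀ ≤ h₁(s)/s ≤ h₀/s₀`. -/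
theorem stmt_16 (s₀ h₀ : ℝ) (hs₀ : 1 ≤ s₀) (hh₀ : 0 < h₀)
    (k : ℝ → ℝ) (hk_cont : ContinuousOn k (Set.Ici s₀))
    (hk_nonneg : ∀ s ∈ Set.Ici s₀, 0 ≤ k s)
    (H h₁ : ℝ → ℝ)
    (hH : ∀ τ, H τ = -Real.exp (-(∫ ξ in s₀..τ, k ξ)))
    (hh₁ : ∀ s, h₁ s = s * (h₀ / s₀ + ∫ τ in s₀..s, H τ / τ ^ 2)) :
    ∃ h₁' h₁'' : ℝ → ℝ,
      ContinuousOn h₁' (Set.Ici s₀) ∧ ContinuousOn h₁'' (Set.Ici s₀) ∧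
      ∀ s ∈ Set.Ici s₀,
        HasDerivWithinAt h₁ (h₁' s) (Set.Ici s₀) s ∧
        HasDerivWithinAt h₁' (h₁'' s) (Set.Ici s₀) s ∧
        h₁'' s + k s * (h₁' s - h₁ s / s) = 0 ∧
        (h₀ - 1) / s₀ ≤ h₁ s / s ∧ h₁ s / s ≤ h₀ / s₀ := by
  have hpos : ∀ s ∈ Set.Ici s₀, 0 < s := fun s hs => by linarith [Set.mem_Ici.1 hs]
  have hHd : ∀ s ∈ Set.Ici s₀, HasDerivWithinAt H (-(k s * H s)) (Set.Ici s₀) s := by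
    intro s hs
    have h := (hasDerivWithinAt_integral_Ici hk_cont hs).neg.exp.neg
    rw [funext hH]
    exact h.congr_deriv (by simp only [Pi.neg_apply]; ring)
  have hHc : ContinuousOn H (Set.Ici s₀) := fun s hs => (hHd s hs).continuousWithinAt
  have hquot : ContinuousOn (fun τ => H τ / τ ^ 2) (Set.Ici s₀) :=
    hHc.div (by fun_prop) fun s hs => (pow_pos (hpos s hs) 2).ne'
  have hId := fun s (hs : s ∈ Set.Ici s₀) => hasDerivWithinAt_integral_Ici hquot hs
  have hIc : ContinuousOn (fun s => ∫ τ in s₀..s, H τ / τ ^ 2) (Set.Ici s₀) :=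
    fun s hs => (hId s hs).continuousWithinAt
  have hratio : ∀ s ∈ Set.Ici s₀, h₁ s / s = h₀ / s₀ + ∫ τ in s₀..s, H τ / τ ^ 2 :=
    fun s hs => by rw [hh₁, mul_div_cancel_left₀ _ (hpos s hs).ne']
  have hH_nonpos : ∀ τ, H τ ≤ 0 := fun τ => by
    rw [hH]; exact neg_nonpos.2 (Real.exp_pos _).le
  have hH_ge : ∀ τ ∈ Set.Ici s₀, -1 ≤ H τ := fun τ hτ => by
    rw [hH, neg_le_neg_iff, Real.exp_le_one_iff, neg_nonpos]
    exact intervalIntegral.integral_nonneg hτ fun u hu => hk_nonneg u hu.1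
  refine ⟨fun s => (h₀ / s₀ + ∫ τ in s₀..s, H τ / τ ^ 2) + H s / s, fun s => -(k s * H s) / s,
    (continuousOn_const.add hIc).add (hHc.div continuousOn_id fun s hs => (hpos s hs).ne'),
    (hk_cont.mul hHc).neg.div continuousOn_id fun s hs => (hpos s hs).ne', ?_⟩
  intro s hs
  have hs0 : s ≠ 0 := (hpos s hs).ne'
  refine ⟨?_, ?_, ?_, ?_, ?_⟩
  · rw [funext hh₁]
    exact ((hasDerivWithinAt_id s _).mul ((hId s hs).const_add (h₀ / s₀))).congr_deriv
      (by simp only [id_eq]; field_simp)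
  · exact (((hId s hs).const_add (h₀ / s₀)).add
      ((hHd s hs).div (hasDerivWithinAt_id s _) hs0)).congr_deriv
      (by simp only [id_eq]; field_simp; ring)
  · rw [hratio s hs]
    field_simp
    ring
  · rw [hratio s hs]
    have hsub : Set.uIcc s₀ s ⊆ Set.Ici s₀ := by
      rw [Set.uIcc_of_le hs]; exact Set.Icc_subset_Ici_self
    have hc : ContinuousOn (fun τ : ℝ => -(τ ^ 2)⁻¹) (Set.uIcc s₀ s) :=
      ((continuousOn_id.pow 2).inv₀ fun τ hτ => (pow_pos (hpos τ (hsub hτ)) 2).ne').neg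
    have hint : ∫ τ in s₀..s, -(τ ^ 2)⁻¹ = s⁻¹ - s₀⁻¹ :=
      intervalIntegral.integral_eq_sub_of_hasDerivAt
        (fun τ hτ => hasDerivAt_inv (hpos τ (hsub hτ)).ne') hc.intervalIntegrable
    have hmono : ∫ τ in s₀..s, -(τ ^ 2)⁻¹ ≤ ∫ τ in s₀..s, H τ / τ ^ 2 := by
      refine intervalIntegral.integral_mono_on hs hc.intervalIntegrable
        (hquot.mono hsub).intervalIntegrable fun τ hτ => ?_
      rw [div_eq_mul_inv, ← neg_one_mul]
      exact mul_le_mul_of_nonneg_right (hH_ge τ hτ.1) (by positivity)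
    have hinv : 0 < s⁻¹ := inv_pos.2 (hpos s hs)
    rw [sub_div, one_div]
    linarith
  · rw [hratio s hs]
    have hI : 0 ≤ ∫ τ in s₀..s, -(H τ / τ ^ 2) :=
      intervalIntegral.integral_nonneg hs fun τ _ =>
        neg_nonneg.2 (div_nonpos_of_nonpos_of_nonneg (hH_nonpos τ) (by positivity))
    rw [intervalIntegral.integral_neg] at hI
    linarith
end

section
/- Let n ≥ 3, A ≥ 1, and let a : [A,∞) → [0,∞) be continuous with isolated zeros and ∫_A^∞ t·a(t) dt < +∞. Define β(s) := (s/(n−2))^{1/(n−2)} and Q(s) := β(s)·β'(s)·a(β(s)) / ((n−2)·s) for s such that β(s) > A. Then for every C > 0 and ρ ∈ (0,1) there exist s₀ ≥ 1 with β(s₀) > A and a twice differentiable solution h : [s₀,∞) → ℝ of h''(s) + Q(s)·h(s) = 0 such that ρ·C ≤ h'(s) < h(s)/s ≤ C for all s > s₀. -/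
open Real MeasureTheory Filter Topology Set Asymptotics

noncomputable section

/-- The change of variables `β(s) = (s/(n-2))^{1/(n-2)}`. -/
def betaFun (n : ℕ) (s : ℝ) : ℝ := (s / ((n : ℝ) - 2)) ^ ((1 : ℝ) / ((n : ℝ) - 2))

/-- `Q(s) = β(s)·β'(s)·a(β(s)) / ((n-2)·s)`,
obtained by radially reducing `Δu + a(|x|)u = 0` via `u = h(s)/s`, `|x| = β(s)`. -/
def Qrad (n : ℕ) (a : ℝ → ℝ) (s : ℝ) : ℝ :=
  betaFun n s * deriv (betaFun n) s * a (betaFun n s) / (((n : ℝ) - 2) * s)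

/-- The linear integral equation `g = C - ∫ q · (C b + ∫ g)` has a solution with values in
`[ρ C, C]` when `∫ t q(t) dt ≤ 1 - ρ`. -/
theorem exists_integral_equation_solution {b C ρ : ℝ} {q : ℝ → ℝ} (hb : 0 < b) (hC : 0 < C)
    (hρ : ρ ∈ Ioo (0 : ℝ) 1) (hq : Continuous q) (hq0 : ∀ t, 0 ≤ q t)
    (hqi : ∀ s, b ≤ s → ∫ t in b..s, t * q t ≤ 1 - ρ) :
    ∃ g : ℝ → ℝ, Continuous g ∧ (∀ s, g s ∈ Icc (ρ * C) C) ∧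
      ∀ s, b ≤ s → g s = C - ∫ t in b..s, q t * (C * b + ∫ u in b..t, g u) := by
  obtain ⟨hρ0, hρ1⟩ := hρ
  have hρC : ρ * C ≤ C := by nlinarith
  let X := BoundedContinuousFunction ℝ (Icc (ρ * C) C)
  let H : X → ℝ → ℝ := fun g t => C * b + ∫ u in b..t, (g u : ℝ)
  have hgc (g : X) : Continuous fun u => (g u : ℝ) := continuous_subtype_val.comp g.continuous
  have hHc (g : X) : Continuous (H g) :=
    continuous_const.add
      (intervalIntegral.continuous_primitive (fun _ _ => (hgc g).intervalIntegrable _ _) b)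
  have hH0 (g : X) {t : ℝ} (ht : b ≤ t) : 0 ≤ H g t := by
    have : 0 ≤ ∫ u in b..t, (g u : ℝ) :=
      intervalIntegral.integral_nonneg ht fun u _ => (by positivity : 0 ≤ ρ * C).trans (g u).2.1
    positivity
  have hH1 (g : X) {t : ℝ} (ht : b ≤ t) : H g t ≤ C * t := by
    have : ∫ u in b..t, (g u : ℝ) ≤ ∫ _u in b..t, C :=
      intervalIntegral.integral_mono_on ht ((hgc g).intervalIntegrable _ _)
        (continuous_const.intervalIntegrable _ _) fun u _ => (g u).2.2
    rw [intervalIntegral.integral_const, smul_eq_mul] at this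
    simp only [H]
    linarith
  have hqH (g : X) : Continuous fun t => q t * H g t := hq.mul (hHc g)
  let T : X → ℝ → ℝ := fun g s => C - ∫ t in b..max b s, q t * H g t
  have hTc (g : X) : Continuous (T g) :=
    continuous_const.sub ((intervalIntegral.continuous_primitive
      (fun _ _ => (hqH g).intervalIntegrable _ _) b).comp (continuous_const.max continuous_id))
  have hT (g : X) (s : ℝ) : T g s ∈ Icc (ρ * C) C := by
    have hs : b ≤ max b s := le_max_left _ _
    have h0 : 0 ≤ ∫ t in b..max b s, q t * H g t :=
      intervalIntegral.integral_nonneg hs fun t ht => mul_nonneg (hq0 t) (hH0 g ht.1)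
    have h1 : ∫ t in b..max b s, q t * H g t ≤ ∫ t in b..max b s, C * (t * q t) :=
      intervalIntegral.integral_mono_on hs ((hqH g).intervalIntegrable _ _)
        (Continuous.intervalIntegrable (by fun_prop) _ _) fun t ht => by
          nlinarith [mul_le_mul_of_nonneg_left (hH1 g ht.1) (hq0 t)]
    rw [intervalIntegral.integral_const_mul] at h1
    have h2 := mul_le_mul_of_nonneg_left (hqi _ hs) hC.le
    constructor <;> simp only [T] <;> linarith
  let F : X → X := fun g =>
    ⟨⟨fun s => ⟨T g s, hT g s⟩, (hTc g).subtype_mk _⟩, ⟨C - ρ * C, fun x y => by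
      exact Real.dist_le_of_mem_Icc (hT g x) (hT g y)⟩⟩
  have hF : ContractingWith (Real.toNNReal (1 - ρ)) F := by
    refine ⟨by simpa using hρ0, LipschitzWith.of_dist_le_mul fun g₁ g₂ => ?_⟩
    have hd : 0 ≤ dist g₁ g₂ := dist_nonneg
    have hK : (0 : ℝ) ≤ 1 - ρ := by linarith
    rw [Real.coe_toNNReal _ hK]
    refine (BoundedContinuousFunction.dist_le (mul_nonneg hK hd)).2 fun s => ?_
    have hs : b ≤ max b s := le_max_left _ _
    change |T g₁ s - T g₂ s| ≤ (1 - ρ) * dist g₁ g₂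
    have hHd {t : ℝ} (ht : b ≤ t) : |H g₂ t - H g₁ t| ≤ dist g₁ g₂ * t := by
      have h := intervalIntegral.norm_integral_le_of_norm_le_const (a := b) (b := t)
        (f := fun u => (g₂ u : ℝ) - g₁ u) (C := dist g₁ g₂) fun u _ => by
          have := BoundedContinuousFunction.dist_coe_le_dist (f := g₂) (g := g₁) u
          rw [dist_comm g₂ g₁] at this
          exact this
      rw [intervalIntegral.integral_sub ((hgc _).intervalIntegrable _ _)
        ((hgc _).intervalIntegrable _ _), Real.norm_eq_abs, abs_of_nonneg (sub_nonneg.2 ht)] at h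
      simp only [H]
      rw [add_sub_add_left_eq_sub]
      nlinarith
    have e : T g₁ s - T g₂ s = ∫ t in b..max b s, q t * (H g₂ t - H g₁ t) := by
      simp only [T, mul_sub]
      rw [intervalIntegral.integral_sub ((hqH _).intervalIntegrable _ _)
        ((hqH _).intervalIntegrable _ _)]
      ring
    rw [e]
    calc |∫ t in b..max b s, q t * (H g₂ t - H g₁ t)|
        ≤ ∫ t in b..max b s, |q t * (H g₂ t - H g₁ t)| :=
          intervalIntegral.abs_integral_le_integral_abs hs
      _ ≤ ∫ t in b..max b s, dist g₁ g₂ * (t * q t) :=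
          intervalIntegral.integral_mono_on hs
            (Continuous.intervalIntegrable (hq.mul ((hHc _).sub (hHc _))).abs _ _)
            (Continuous.intervalIntegrable (by fun_prop) _ _) fun t ht => by
              rw [abs_mul, abs_of_nonneg (hq0 t)]
              nlinarith [mul_le_mul_of_nonneg_left (hHd ht.1) (hq0 t)]
      _ = dist g₁ g₂ * ∫ t in b..max b s, t * q t := intervalIntegral.integral_const_mul _ _
      _ ≤ dist g₁ g₂ * (1 - ρ) := mul_le_mul_of_nonneg_left (hqi _ hs) hd
      _ = (1 - ρ) * dist g₁ g₂ := mul_comm _ _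
  have : Nonempty X := ⟨BoundedContinuousFunction.const ℝ ⟨C, hρC, le_rfl⟩⟩
  let g := ContractingWith.fixedPoint F hF
  have hg : F g = g := hF.fixedPoint_isFixedPt
  refine ⟨fun u => (g u : ℝ), hgc g, fun s => (g s).2, fun s hs => ?_⟩
  have h : T g s = g s := congrArg Subtype.val (DFunLike.congr_fun hg s)
  simp only [T, H, max_eq_right hs] at h
  exact h.symm

/-- The equation `h'' + q h = 0` has a solution on `(b, ∞)` that is close to a line through the
origin when `q ≥ 0` is continuous, `∫ t q(t) dt` is small, and `q` vanishes on no interval. -/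
theorem exists_almost_linear_solution {b C ρ : ℝ} {q : ℝ → ℝ} (hb : 0 < b) (hC : 0 < C)
    (hρ : ρ ∈ Ioo (0 : ℝ) 1) (hq : ContinuousOn q (Ici b)) (hq0 : ∀ t ∈ Ici b, 0 ≤ q t)
    (hqi : ∀ s, b ≤ s → ∫ t in b..s, t * q t ≤ 1 - ρ)
    (hne : ∀ s, b < s → ∃ t ∈ Ioo b s, q t ≠ 0) :
    ∃ h h' : ℝ → ℝ, ∀ s, b < s →
      HasDerivAt h (h' s) s ∧ HasDerivAt h' (-(q s * h s)) s ∧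
        ρ * C ≤ h' s ∧ h' s < h s / s ∧ h s / s ≤ C := by
  set p : ℝ → ℝ := fun t => q (max b t) with hp
  have hpq {t : ℝ} (ht : b ≤ t) : p t = q t := by simp only [hp, max_eq_right ht]
  have hpc : Continuous p :=
    hq.comp_continuous (continuous_const.max continuous_id) fun t => mem_Ici.2 (le_max_left _ _)
  obtain ⟨g, hgc, hgm, hg⟩ := exists_integral_equation_solution hb hC hρ hpc
    (fun t => hq0 _ (mem_Ici.2 (le_max_left _ _))) fun s hs => by
      refine (intervalIntegral.integral_congr fun t ht => ?_).trans_le (hqi s hs)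
      rw [uIcc_of_le hs] at ht
      simp only [hpq ht.1]
  set h : ℝ → ℝ := fun t => C * b + ∫ u in b..t, g u with hh
  have hgi (x y : ℝ) : IntervalIntegrable g volume x y := hgc.intervalIntegrable _ _
  have hhd (s : ℝ) : HasDerivAt h (g s) s :=
    (intervalIntegral.integral_hasDerivAt_right (hgi b s)
      (hgc.stronglyMeasurableAtFilter _ _) hgc.continuousAt).const_add _
  have hhc : Continuous h := continuous_iff_continuousAt.2 fun s => (hhd s).continuousAt
  have hgd {s : ℝ} (hs : b < s) : HasDerivAt g (-(q s * h s)) s := by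
    have hc : Continuous fun t => p t * h t := hpc.mul hhc
    have := (intervalIntegral.integral_hasDerivAt_right (hc.intervalIntegrable b s)
      (hc.stronglyMeasurableAtFilter _ _) hc.continuousAt).const_sub C
    rw [hpq hs.le] at this
    refine this.congr_of_eventuallyEq ?_
    filter_upwards [Ioi_mem_nhds hs] with t ht using hg t (le_of_lt ht)
  have hρC : 0 < ρ * C := mul_pos hρ.1 hC
  have hpos {s : ℝ} (hs : b ≤ s) : 0 < h s := by
    have : 0 ≤ ∫ u in b..s, g u :=
      intervalIntegral.integral_nonneg hs fun u _ => hρC.le.trans (hgm u).1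
    positivity
  have hle {s : ℝ} (hs : b ≤ s) : h s ≤ C * s := by
    have : ∫ u in b..s, g u ≤ ∫ _u in b..s, C :=
      intervalIntegral.integral_mono_on hs (hgi _ _)
        (continuous_const.intervalIntegrable _ _) fun u _ => (hgm u).2
    rw [intervalIntegral.integral_const, smul_eq_mul] at this
    simp only [hh]
    linarith
  set w : ℝ → ℝ := fun s => h s - s * g s with hw
  have hwd {s : ℝ} (hs : b < s) : HasDerivAt w (s * (q s * h s)) s := by
    refine ((hhd s).sub ((hasDerivAt_id s).mul (hgd hs))).congr_deriv ?_
    simp only [id]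
    ring
  have hwm : MonotoneOn w (Ici b) := by
    refine monotoneOn_of_deriv_nonneg (convex_Ici b) (by fun_prop) ?_ ?_ <;>
      rw [interior_Ici]
    · exact fun s hs => (hwd hs).differentiableAt.differentiableWithinAt
    · intro s hs
      have hs' : b < s := hs
      rw [(hwd hs).deriv]
      exact mul_nonneg (hb.trans hs).le (mul_nonneg (hq0 s hs'.le) (hpos hs'.le).le)
  have hwb : w b = 0 := by
    have := hg b le_rfl
    simp only [intervalIntegral.integral_same, sub_zero] at this
    simp only [hw, hh, intervalIntegral.integral_same, this]
    ring
  have hwpos {s : ℝ} (hs : b < s) : 0 < w s := by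
    by_contra! hws
    obtain ⟨t, ht, hqt⟩ := hne s hs
    have hz : w =ᶠ[𝓝 t] fun _ => 0 := by
      filter_upwards [Ioo_mem_nhds ht.1 ht.2] with u hu
      have h1 := hwm self_mem_Ici hu.1.le hu.1.le
      have h2 := hwm hu.1.le hs.le hu.2.le
      linarith
    have h0 := (hwd ht.1).unique ((hasDerivAt_const t (0 : ℝ)).congr_of_eventuallyEq hz)
    exact mul_ne_zero (hb.trans ht.1).ne' (mul_ne_zero hqt (hpos ht.1.le).ne') h0
  refine ⟨h, g, fun s hs => ⟨hhd s, hgd hs, (hgm s).1, ?_, ?_⟩⟩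
  · rw [lt_div_iff₀ (hb.trans hs)]
    linarith [hwpos hs, mul_comm s (g s)]
  · rw [div_le_iff₀ (hb.trans hs)]
    exact hle hs.le

theorem natCast_sub_two_pos {n : ℕ} (hn : 3 ≤ n) : (0 : ℝ) < n - 2 := by
  have : (3 : ℝ) ≤ n := by exact_mod_cast hn
  linarith

theorem hasDerivAt_betaFun {n : ℕ} (hn : 3 ≤ n) {s : ℝ} (hs : 0 < s) :
    HasDerivAt (betaFun n) (1 / ((n : ℝ) - 2) * (1 / ((n : ℝ) - 2)) *
      (s / ((n : ℝ) - 2)) ^ (1 / ((n : ℝ) - 2) - 1)) s := by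
  have hk := natCast_sub_two_pos hn
  exact ((hasDerivAt_id s).div_const ((n : ℝ) - 2)).rpow_const (p := 1 / ((n : ℝ) - 2))
    (Or.inl (div_pos hs hk).ne')

theorem deriv_betaFun_pos {n : ℕ} (hn : 3 ≤ n) {s : ℝ} (hs : 0 < s) :
    0 < deriv (betaFun n) s := by
  have hk := natCast_sub_two_pos hn
  rw [(hasDerivAt_betaFun hn hs).deriv]
  positivity

theorem continuousOn_deriv_betaFun {n : ℕ} (hn : 3 ≤ n) :
    ContinuousOn (deriv (betaFun n)) (Ioi 0) := by
  have hk := natCast_sub_two_pos hn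
  refine ContinuousOn.congr ?_ fun s hs => (hasDerivAt_betaFun hn hs).deriv
  refine continuousOn_const.mul (ContinuousOn.rpow_const (by fun_prop) fun s hs => Or.inl ?_)
  exact (div_pos hs hk).ne'

theorem strictMonoOn_betaFun {n : ℕ} (hn : 3 ≤ n) : StrictMonoOn (betaFun n) (Ioi 0) := by
  refine strictMonoOn_of_deriv_pos (convex_Ioi 0)
    (fun s hs => (hasDerivAt_betaFun hn hs).continuousAt.continuousWithinAt) fun s hs => ?_
  rw [interior_Ioi] at hs
  exact deriv_betaFun_pos hn hs

theorem tendsto_betaFun {n : ℕ} (hn : 3 ≤ n) : Tendsto (betaFun n) atTop atTop := by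
  have hk := natCast_sub_two_pos hn
  exact (tendsto_rpow_atTop (by positivity)).comp (tendsto_id.atTop_div_const hk)

/-- The integrals of a function integrable on a half-line are uniformly small far out. -/
theorem eventually_intervalIntegral_lt {f : ℝ → ℝ} {A ε : ℝ} (hf : IntegrableOn f (Ici A))
    (hε : 0 < ε) : ∀ᶠ x in atTop, ∀ y, x ≤ y → ∫ t in x..y, f t < ε := by
  have hf' : IntegrableOn f (Ioi A) := hf.mono_set Ioi_subset_Ici_self
  have hlim := intervalIntegral_tendsto_integral_Ioi A hf' tendsto_id
  obtain ⟨B, hB⟩ := eventually_atTop.1 ((Metric.tendsto_nhds.1 hlim) (ε / 2) (half_pos hε))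
  filter_upwards [eventually_ge_atTop (max A B)] with x hx y hxy
  have hAx : A ≤ x := (le_max_left _ _).trans hx
  have hBx : B ≤ x := (le_max_right _ _).trans hx
  have hi {z : ℝ} (hz : A ≤ z) : IntervalIntegrable f volume A z :=
    (intervalIntegrable_iff_integrableOn_Icc_of_le hz).2 (hf.mono_set Icc_subset_Ici_self)
  have h1 := hB x hBx
  have h2 := hB y (hBx.trans hxy)
  rw [Real.dist_eq, abs_lt] at h1 h2
  rw [← intervalIntegral.integral_interval_sub_left (hi (hAx.trans hxy)) (hi hAx)]
  simp only [id] at h1 h2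
  linarith

theorem intervalIntegral_mul_Qrad {n : ℕ} (hn : 3 ≤ n) {a : ℝ → ℝ} {A b s : ℝ}
    (ha : ContinuousOn a (Ici A)) (hb : 0 < b) (hA : A ≤ betaFun n b) (hbs : b ≤ s) :
    ∫ t in b..s, t * Qrad n a t =
      1 / ((n : ℝ) - 2) * ∫ t in betaFun n b..betaFun n s, t * a t := by
  have hsub : uIcc b s ⊆ Ioi 0 := by
    rw [uIcc_of_le hbs]
    exact fun t ht => hb.trans_le ht.1
  have him : betaFun n '' uIcc b s ⊆ Ici A := by
    rintro _ ⟨t, ht, rfl⟩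
    have ht0 := hsub ht
    rw [uIcc_of_le hbs] at ht
    exact hA.trans ((strictMonoOn_betaFun hn).monotoneOn hb ht0 ht.1)
  rw [← intervalIntegral.integral_comp_mul_deriv' (g := fun t => t * a t) (f' := deriv (betaFun n))
    (fun t ht => (hasDerivAt_betaFun hn (hsub ht)).differentiableAt.hasDerivAt)
    ((continuousOn_deriv_betaFun hn).mono hsub)
    ((continuousOn_id.mul ha).mono him), ← intervalIntegral.integral_const_mul]
  refine intervalIntegral.integral_congr fun t ht => ?_
  have ht0 : t ≠ 0 := (hsub ht).ne'
  simp only [Qrad, Function.comp]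
  field_simp

/-- For `n ≥ 3` and `a : [A,∞) → [0,∞)` continuous with isolated zeros and
`∫_A^∞ t·a(t) dt < ∞`, for every `C > 0` and `ρ ∈ (0,1)` there exist `s₀ ≥ 1` with
`β(s₀) > A` and a twice differentiable solution of `h'' + Q(s)·h = 0` on `[s₀,∞)` with
`ρC ≤ h'(s) < h(s)/s ≤ C` for all `s > s₀`. -/
theorem stmt_17 (n : ℕ) (hn : 3 ≤ n) (A : ℝ) (hA : 1 ≤ A)
    (a : ℝ → ℝ) (ha_cont : ContinuousOn a (Set.Ici A))
    (ha_nonneg : ∀ t ∈ Set.Ici A, 0 ≤ a t)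
    (ha_iso : ∀ t ∈ Set.Ici A, a t = 0 → ∀ᶠ s in 𝓝[≠] t, a s ≠ 0)
    (ha_int : IntegrableOn (fun t => t * a t) (Set.Ici A)) :
    ∀ C : ℝ, 0 < C → ∀ ρ ∈ Set.Ioo (0 : ℝ) 1,
      ∃ s₀ : ℝ, 1 ≤ s₀ ∧ A < betaFun n s₀ ∧
        ∃ h h' : ℝ → ℝ,
          (∀ s ∈ Set.Ici s₀, HasDerivAt h (h' s) s ∧
            HasDerivAt h' (-(Qrad n a s * h s)) s) ∧
          ∀ s, s₀ < s → ρ * C ≤ h' s ∧ h' s < h s / s ∧ h s / s ≤ C := by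
  intro C hC ρ hρ
  have hk : (1 : ℝ) ≤ n - 2 := by
    have : (3 : ℝ) ≤ n := by exact_mod_cast hn
    linarith
  have hβ := tendsto_betaFun hn
  obtain ⟨b, hb1, hAb, hsmall⟩ := ((eventually_ge_atTop (1 : ℝ)).and
    ((hβ.eventually_gt_atTop A).and (hβ.eventually
      (eventually_intervalIntegral_lt ha_int (sub_pos.2 hρ.2))))).exists
  have hb : 0 < b := one_pos.trans_le hb1
  have hβb {t : ℝ} (ht : b ≤ t) : A < betaFun n t :=
    hAb.trans_le ((strictMonoOn_betaFun hn).monotoneOn hb (hb.trans_le ht) ht)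
  have hβc : ContinuousOn (betaFun n) (Ici b) := fun t ht =>
    (hasDerivAt_betaFun hn (hb.trans_le ht)).continuousAt.continuousWithinAt
  have hq : ContinuousOn (Qrad n a) (Ici b) := by
    refine ContinuousOn.div ((hβc.mul ((continuousOn_deriv_betaFun hn).mono
      fun t ht => hb.trans_le ht)).mul (ha_cont.comp hβc fun t ht => (hβb ht).le))
      (by fun_prop) fun t ht => ?_
    exact (mul_pos (one_pos.trans_le hk) (hb.trans_le ht)).ne'
  have hq0 : ∀ t ∈ Ici b, 0 ≤ Qrad n a t := fun t ht => by
    have ht0 : 0 < t := hb.trans_le ht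
    have hβt := hβb ht
    exact div_nonneg (mul_nonneg (mul_nonneg (by linarith) (deriv_betaFun_pos hn ht0).le)
      (ha_nonneg _ hβt.le)) (mul_nonneg (by linarith) ht0.le)
  have hqi : ∀ s, b ≤ s → ∫ t in b..s, t * Qrad n a t ≤ 1 - ρ := fun s hs => by
    have hle := (strictMonoOn_betaFun hn).monotoneOn hb (hb.trans_le hs) hs
    rw [intervalIntegral_mul_Qrad hn ha_cont hb hAb.le hs, one_div, inv_mul_le_iff₀ (by linarith)]
    nlinarith [hsmall _ hle, hρ.2]
  have hne : ∀ s, b < s → ∃ t ∈ Ioo b s, Qrad n a t ≠ 0 := fun s hs => by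
    have hlt := strictMonoOn_betaFun hn hb (hb.trans hs) hs
    obtain ⟨x, hx, hax⟩ : ∃ x ∈ Ioo (betaFun n b) (betaFun n s), a x ≠ 0 := by
      obtain ⟨m, hm⟩ := exists_between hlt
      by_cases ham : a m = 0
      · exact ((eventually_nhdsWithin_of_eventually_nhds (Ioo_mem_nhds hm.1 hm.2)).and
          (ha_iso m (hAb.trans hm.1).le ham)).exists
      · exact ⟨m, hm, ham⟩
    obtain ⟨t, ht, rfl⟩ := intermediate_value_Ioo hs.le (hβc.mono Icc_subset_Ici_self) hx
    have ht0 : 0 < t := hb.trans ht.1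
    have hβt := hβb ht.1.le
    exact ⟨t, ht, div_ne_zero (mul_ne_zero (mul_ne_zero (by linarith)
      (deriv_betaFun_pos hn ht0).ne') hax) (mul_ne_zero (by linarith) ht0.ne')⟩
  obtain ⟨h, h', hsol⟩ := exists_almost_linear_solution hb hC hρ hq hq0 hqi hne
  have hlt : b < b + 1 := lt_add_one b
  refine ⟨b + 1, by linarith, hβb hlt.le, h, h', fun s hs => ?_, fun s hs => ?_⟩
  · obtain ⟨h1, h2, -⟩ := hsol s (hlt.trans_le hs)
    exact ⟨h1, h2⟩
  · exact (hsol s (hlt.trans hs)).2.2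
end
end
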